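/- The Laurent polynomial module ℂ[x,x⁻¹] has an invariant subspace other than 0 and ℂ[x,x⁻¹] (i.e. j₀M is reducible) if and only if both of the following hold: (a) x·p has no terms of negative degree; and (b) there exists an integer k with k + p₋₁ + Σ_{i=1}^{m−1} 2c_i(1−λ^{ik})/(1−λ^i) = 0. -/

import Mathlib

noncomputable section

/-- The Laurent polynomial ring `ℂ[x,x⁻¹]`, viewed as the space of finitely supported
coefficient functions `ℤ →₀ ℂ`; the monomial `x^n` is `Finsupp.single n 1`. -/
abbrev LaurentC : Type := ℤ →₀ ℂ

/-- The `ℂ`-linear endomorphism of `ℂ[x,x⁻¹]` determined by its values on the monomials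
`x^n`, `n : ℤ`. -/
noncomputable def onMonomials (g : ℤ → LaurentC) : LaurentC →ₗ[ℂ] LaurentC :=
  Finsupp.lsum ℂ fun n => LinearMap.toSpanSingleton ℂ LaurentC (g n)

/-- Multiplication by `x`. -/
noncomputable def mulX : LaurentC →ₗ[ℂ] LaurentC :=
  onMonomials fun n => Finsupp.single (n + 1) 1

/-- The operator `s_i : x^n ↦ λ^{i n} x^n`. -/
noncomputable def sOp (lam : ℂ) (i : ℕ) : LaurentC →ₗ[ℂ] LaurentC :=
  onMonomials fun n => Finsupp.single n (lam ^ ((i : ℤ) * n))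

/-- The Dunkl operator
`D(x^n) = n x^{n-1} + p·x^n + Σ_{i=1}^{m-1} (2 c_i (1-λ^{in})/(1-λ^i)) x^{n-1}`. -/
noncomputable def dunkl (m : ℕ) (lam : ℂ) (c : ℕ → ℂ) (p : LaurentC) : LaurentC →ₗ[ℂ] LaurentC :=
  onMonomials fun n =>
    Finsupp.mapDomain (· + n) p +
      ((n : ℂ) + ∑ i ∈ Finset.Icc 1 (m - 1),
          2 * c i * (1 - lam ^ ((i : ℤ) * n)) / (1 - lam ^ (i : ℤ))) • Finsupp.single (n - 1) 1

/-- A subspace `N ⊆ ℂ[x,x⁻¹]` is an invariant subspace if it is closed under multiplication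
by `x`, under `s_1`, and under the Dunkl operator `D`; invariant subspaces are exactly the
submodules of the rational Cherednik algebra module `j₀M`. -/
def IsInvariantSubspace (m : ℕ) (lam : ℂ) (c : ℕ → ℂ) (p : LaurentC) (N : Submodule ℂ LaurentC) : Prop :=
  (∀ f ∈ N, mulX f ∈ N) ∧ (∀ f ∈ N, sOp lam 1 f ∈ N) ∧ (∀ f ∈ N, dunkl m lam c p f ∈ N)

/-- The subspace `x^k ℂ[x]`: the span of the monomials `x^n` with `n ≥ k`. -/
noncomputable def tailSpace (k : ℤ) : Submodule ℂ LaurentC :=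
  Submodule.span ℂ {f : LaurentC | ∃ n : ℤ, k ≤ n ∧ f = Finsupp.single n 1}

def Tsh (a : ℤ) : LaurentC →ₗ[ℂ] LaurentC := Finsupp.lmapDomain ℂ ℂ (· + a)

def dg (r : ℤ → ℂ) : LaurentC →ₗ[ℂ] LaurentC := onMonomials fun n => Finsupp.single n (r n)

def rho (m : ℕ) (lam : ℂ) (c : ℕ → ℂ) (n : ℤ) : ℂ :=
  (n : ℂ) + ∑ i ∈ Finset.Icc 1 (m - 1),
          2 * c i * (1 - lam ^ ((i : ℤ) * n)) / (1 - lam ^ (i : ℤ))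

theorem onMonomials_single (g : ℤ → LaurentC) (n : ℤ) (b : ℂ) :
    onMonomials g (Finsupp.single n b) = b • g n := by
  simp [onMonomials]

theorem Tsh_single (a n : ℤ) (b : ℂ) :
    Tsh a (Finsupp.single n b) = Finsupp.single (n + a) b := by
  simp [Tsh]

theorem Tsh_apply (a n : ℤ) (f : LaurentC) : Tsh a f n = f (n - a) := by
  have h := Finsupp.mapDomain_apply (add_left_injective a) f (n - a)
  simpa [Tsh] using h

theorem dg_apply (r : ℤ → ℂ) (f : LaurentC) (n : ℤ) : dg r f n = r n * f n := by
  induction f using Finsupp.induction_linear with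
  | zero => simp
  | add f g hf hg => simp [hf, hg, mul_add]
  | single k b =>
    rw [dg, onMonomials_single]
    by_cases h : k = n
    · subst h; simp [mul_comm]
    · simp [h]

theorem mulX_eq : mulX = Tsh 1 := by
  ext n : 1
  ext : 1
  simp [mulX, onMonomials_single, Tsh_single]

theorem Tsh_Tsh (a b : ℤ) (f : LaurentC) : Tsh a (Tsh b f) = Tsh (a + b) f := by
  ext n
  simp only [Tsh_apply]
  congr 1; ring

theorem dunkl_eq (m : ℕ) (lam : ℂ) (c : ℕ → ℂ) (p f : LaurentC) :
    dunkl m lam c p f = (∑ j ∈ p.support, p j • Tsh j f) + Tsh (-1) (dg (rho m lam c) f) := by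
  induction f using Finsupp.induction_linear with
  | zero => simp
  | add f g hf hg =>
    simp only [map_add, hf, hg, smul_add, Finset.sum_add_distrib]; abel
  | single k b =>
    rw [dunkl, onMonomials_single, dg, onMonomials_single, map_smul, Tsh_single, smul_add]
    congr 1
    · rw [Finsupp.mapDomain, Finsupp.sum, Finset.smul_sum]
      refine Finset.sum_congr rfl fun j _ => ?_
      rw [Tsh_single, Finsupp.smul_single, Finsupp.smul_single, smul_eq_mul, smul_eq_mul, mul_comm,
        add_comm j k]
    · simp [rho, sub_eq_add_neg]

theorem dunkl_apply (m : ℕ) (lam : ℂ) (c : ℕ → ℂ) (p f : LaurentC) (n : ℤ) :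
    dunkl m lam c p f n
      = (∑ j ∈ p.support, p j * f (n - j)) + rho m lam c (n + 1) * f (n + 1) := by
  rw [dunkl_eq]
  simp [Tsh_apply, dg_apply, Finsupp.finset_sum_apply]

theorem dunkl_single_apply (m : ℕ) (lam : ℂ) (c : ℕ → ℂ) (p : LaurentC) (k n : ℤ) :
    dunkl m lam c p (Finsupp.single k 1) n
      = p (n - k) + if n = k - 1 then rho m lam c k else 0 := by
  rw [dunkl, onMonomials_single, one_smul, Finsupp.add_apply]
  congr 1
  · have h := Tsh_apply k n p
    simpa [Tsh] using h
  · by_cases h : n = k - 1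
    · subst h; simp [rho]
    · simp [h, Finsupp.single_apply, Ne.symm h]

theorem Tsh_mem {N : Submodule ℂ LaurentC} (h : ∀ f ∈ N, mulX f ∈ N) (a : ℤ) (ha : 0 ≤ a)
    (f : LaurentC) (hf : f ∈ N) : Tsh a f ∈ N := by
  obtain ⟨a, rfl⟩ := Int.eq_ofNat_of_zero_le ha
  clear ha
  induction a with
  | zero =>
    have : Tsh ((0 : ℕ) : ℤ) f = f := by ext n; simp [Tsh_apply]
    rwa [this]
  | succ a ih =>
    have := h _ ih
    rw [mulX_eq, Tsh_Tsh] at this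
    convert this using 2
    push_cast; ring

theorem exists_shift {m : ℕ} {lam : ℂ} {c : ℕ → ℂ} {p : LaurentC} {N : Submodule ℂ LaurentC}
    (h : IsInvariantSubspace m lam c p N) :
    ∃ a : ℤ, 0 ≤ a ∧ ∀ f ∈ N, Tsh a (dg (rho m lam c) f) ∈ N := by
  obtain ⟨b, hb⟩ : ∃ b : ℤ, ∀ j ∈ p.support, b ≤ j := by
    obtain ⟨b, hb⟩ := p.support.bddBelow
    exact ⟨b, fun j hj => hb hj⟩
  refine ⟨|b|, abs_nonneg b, fun f hf => ?_⟩
  have hb' := neg_abs_le b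
  have h1 := Tsh_mem h.1 (|b| + 1) (by positivity) _ (h.2.2 f hf)
  rw [dunkl_eq, map_add, Tsh_Tsh, map_sum] at h1
  have h2 : ∑ j ∈ p.support, Tsh (|b| + 1) (p j • Tsh j f) ∈ N := by
    refine N.sum_mem fun j hj => ?_
    rw [map_smul, Tsh_Tsh]
    refine N.smul_mem _ (Tsh_mem h.1 _ ?_ f hf)
    have := hb j hj
    linarith
  have h3 := (N.add_mem_iff_right h2).1 h1
  simpa using h3

theorem exists_monomial {m : ℕ} {lam : ℂ} {c : ℕ → ℂ} {p : LaurentC} {N : Submodule ℂ LaurentC}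
    (h : IsInvariantSubspace m lam c p N) (hN : N ≠ ⊥) :
    ∃ k : ℤ, Finsupp.single k (1 : ℂ) ∈ N := by
  obtain ⟨a, ha, hD⟩ := exists_shift h
  obtain ⟨f0, hf0, hf0'⟩ := N.ne_bot_iff.1 hN
  suffices H : ∀ s : ℕ, ∀ f ∈ N, f ≠ 0 → f.support.card ≤ s →
      ∃ k : ℤ, Finsupp.single k (1 : ℂ) ∈ N from H _ f0 hf0 hf0' le_rfl
  intro s
  induction s with
  | zero =>
    intro f _ hne hc
    simp at hc; exact absurd hc hne
  | succ s ih =>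
    intro f hf hne hc
    obtain ⟨n1, hn1⟩ := Finsupp.support_nonempty_iff.2 hne
    by_cases hex : ∃ n2 ∈ f.support, n2 ≠ n1
    · obtain ⟨n2, hn2, h12⟩ := hex
      -- a diagonal operator separating `n1` and `n2`
      obtain ⟨r, hr, b, hb⟩ : ∃ r : ℤ → ℂ, r n1 ≠ r n2 ∧ ∃ b : ℤ, 
          Tsh b (dg r f) ∈ N ∧ Tsh b f ∈ N := by
        by_cases hl : lam ^ n1 = lam ^ n2
        · refine ⟨rho m lam c, ?_, a, hD f hf, Tsh_mem h.1 a ha f hf⟩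
          have hl' : ∀ i : ℕ, lam ^ ((i : ℤ) * n1) = lam ^ ((i : ℤ) * n2) := by
            intro i
            rw [mul_comm, zpow_mul, hl, ← zpow_mul, mul_comm]
          simp only [rho, hl', ne_eq, add_left_inj, Int.cast_inj]
          exact Ne.symm h12
        · refine ⟨fun n => lam ^ n, hl, 0, Tsh_mem h.1 0 le_rfl _ ?_, Tsh_mem h.1 0 le_rfl f hf⟩
          have := h.2.1 f hf
          simpa [sOp, dg] using this
      have hg : Tsh b (dg r f) - r n1 • Tsh b f ∈ N := N.sub_mem hb.1 (N.smul_mem _ hb.2)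
      set g := Tsh b (dg r f) - r n1 • Tsh b f with hgdef
      have hgv : ∀ n, g n = (r (n - b) - r n1) * f (n - b) := by
        intro n
        simp [hgdef, Tsh_apply, dg_apply, sub_mul]
      refine ih g hg ?_ ?_
      · intro h0
        have := hgv (n2 + b)
        rw [h0] at this
        simp only [Finsupp.coe_zero, Pi.zero_apply, add_sub_cancel_right] at this
        rcases mul_eq_zero.1 this.symm with h' | h'
        · exact hr (sub_eq_zero.1 h').symm
        · exact (Finsupp.mem_support_iff.1 hn2) h'
      · have hsub : g.support ⊆ (f.support.erase n1).image (· + b) := by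
          intro n hn
          rw [Finsupp.mem_support_iff, hgv] at hn
          rw [Finset.mem_image]
          refine ⟨n - b, Finset.mem_erase.2 ⟨?_, ?_⟩, by ring⟩
          · intro he; rw [he] at hn; simp at hn
          · exact Finsupp.mem_support_iff.2 (right_ne_zero_of_mul hn)
        have h1 := Finset.card_le_card hsub
        have h2 := Finset.card_image_le (s := f.support.erase n1) (f := (· + b))
        have h3 := Finset.card_erase_of_mem hn1
        omega
    · push Not at hex
      refine ⟨n1, ?_⟩
      have hfe : f = Finsupp.single n1 (f n1) := by
        ext n
        by_cases hn : n = n1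
        · subst hn; simp
        · have : f n = 0 := by
            by_contra hh
            exact hn (hex n (Finsupp.mem_support_iff.2 hh))
          simp [this, Finsupp.single_apply, Ne.symm hn]
      have h0 := Finsupp.mem_support_iff.1 hn1
      have h1 := N.smul_mem (f n1)⁻¹ hf
      rw [hfe] at h1
      simpa [h0] using h1

theorem mem_of_low {N : Submodule ℂ LaurentC} {K : ℤ}
    (h : ∀ n, K ≤ n → Finsupp.single n (1 : ℂ) ∈ N) (f : LaurentC) (hf : ∀ n < K, f n = 0) :
    f ∈ N := by
  rw [← Finsupp.sum_single f]
  refine N.sum_mem fun n hn => ?_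
  have : K ≤ n := by
    by_contra hh
    exact Finsupp.mem_support_iff.1 hn (hf n (by omega))
  have h1 := N.smul_mem (f n) (h n this)
  simpa using h1

theorem coeff_zero {N : Submodule ℂ LaurentC} {K : ℤ}
    (h : ∀ n, K ≤ n → Finsupp.single n (1 : ℂ) ∈ N) (hK : Finsupp.single (K - 1) (1 : ℂ) ∉ N)
    (f : LaurentC) (hfN : f ∈ N) (hf : ∀ n < K - 1, f n = 0) : f (K - 1) = 0 := by
  by_contra h0
  apply hK
  have h1 : f - Finsupp.single (K - 1) (f (K - 1)) ∈ N := by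
    refine mem_of_low h _ fun n hn => ?_
    by_cases hn' : n = K - 1
    · subst hn'; simp
    · simp [hf n (by omega), Finsupp.single_apply, Ne.symm hn']
  have h2 := N.sub_mem hfN h1
  rw [sub_sub_cancel] at h2
  have h3 := N.smul_mem (f (K - 1))⁻¹ h2
  simpa [h0] using h3

theorem exists_least {N : Submodule ℂ LaurentC} (h : ∀ f ∈ N, mulX f ∈ N) (hN : N ≠ ⊤)
    {k : ℤ} (hk : Finsupp.single k (1 : ℂ) ∈ N) :
    ∃ K : ℤ, (∀ n, K ≤ n → Finsupp.single n (1 : ℂ) ∈ N) ∧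
      Finsupp.single (K - 1) (1 : ℂ) ∉ N := by
  have up : ∀ K n : ℤ, K ≤ n → Finsupp.single K (1 : ℂ) ∈ N → Finsupp.single n (1 : ℂ) ∈ N := by
    intro K n hKn hK
    have := Tsh_mem h (n - K) (by omega) _ hK
    rw [Tsh_single] at this
    simpa using this
  by_contra! H
  have all : ∀ d : ℕ, Finsupp.single (k - d) (1 : ℂ) ∈ N := by
    intro d
    induction d with
    | zero => simpa using hk
    | succ d ih =>
      have := H (k - d) fun n hn => up _ _ hn ih
      convert this using 2
      push_cast; ring
  apply hN
  rw [eq_top_iff]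
  intro f _
  rw [← Finsupp.sum_single f]
  refine N.sum_mem fun n _ => ?_
  have h0 : Finsupp.single n (1 : ℂ) ∈ N := 
    up (k - (k - n).toNat) n (by omega) (all _)
  have h1 := N.smul_mem (f n) h0
  simpa using h1

/-- `j₀M` is reducible iff `x·p` has no terms of negative degree and there is an integer `k`
with `k + p₋₁ + Σ_{i=1}^{m−1} 2c_i(1−λ^{ik})/(1−λ^i) = 0`. -/
theorem reducible_iff
    (m : ℕ) (hm : 2 ≤ m) (lam : ℂ) (hlam : IsPrimitiveRoot lam m)
    (c : ℕ → ℂ) (p : LaurentC) (hp : ∀ n : ℤ, ¬ ((m : ℤ) ∣ (n + 1)) → p n = 0) :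
    (∃ N : Submodule ℂ LaurentC, IsInvariantSubspace m lam c p N ∧ N ≠ ⊥ ∧ N ≠ ⊤) ↔
      ((∀ n : ℤ, n < -1 → p n = 0) ∧
        ∃ k : ℤ, (k : ℂ) + p (-1) + ∑ i ∈ Finset.Icc 1 (m - 1),
            2 * c i * (1 - lam ^ ((i : ℤ) * k)) / (1 - lam ^ (i : ℤ)) = 0) := by
  constructor
  · rintro ⟨N, hinv, hbot, htop⟩
    obtain ⟨k, hk⟩ := exists_monomial hinv hbot
    obtain ⟨K, hK, hK1⟩ := exists_least hinv.1 htop hk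
    have hDK := hinv.2.2 _ (hK K le_rfl)
    have ha : ∀ n : ℤ, n < -1 → p n = 0 := by
      by_contra! H
      obtain ⟨j, hj, hpj⟩ := H
      have hne : p.support.Nonempty := ⟨j, Finsupp.mem_support_iff.2 hpj⟩
      set j0 := p.support.min' hne with hj0
      have hj0m : p j0 ≠ 0 := Finsupp.mem_support_iff.1 (p.support.min'_mem hne)
      have hj0j : j0 ≤ j := p.support.min'_le j (Finsupp.mem_support_iff.2 hpj)
      have hlow : ∀ n < j0, p n = 0 := by
        intro n hn
        by_contra hh
        have := p.support.min'_le n (Finsupp.mem_support_iff.2 hh)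
        omega
      have h1 := Tsh_mem hinv.1 (-1 - j0) (by omega) _ hDK
      have h2 := coeff_zero hK hK1 _ h1 (fun n hn => by
        rw [Tsh_apply, dunkl_single_apply, hlow _ (by omega), if_neg (by omega), add_zero])
      rw [Tsh_apply, dunkl_single_apply, if_neg (by omega), add_zero] at h2
      apply hj0m
      rw [← h2]
      congr 1; ring
    refine ⟨ha, K, ?_⟩
    have h2 := coeff_zero hK hK1 _ hDK (fun n hn => by
      rw [dunkl_single_apply, ha _ (by omega), if_neg (by omega), add_zero])
    rw [dunkl_single_apply, if_pos rfl, show K - 1 - K = -1 by ring, rho] at h2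
    rw [← h2]; ring
  · rintro ⟨ha, k, hk⟩
    let N : Submodule ℂ LaurentC :=
      { carrier := {f | ∀ n < k, f n = 0}
        add_mem' := fun {f g} hf hg n hn => by simp [hf n hn, hg n hn]
        zero_mem' := fun n _ => rfl
        smul_mem' := fun b f hf n hn => by simp [hf n hn] }
    have hmem : ∀ f, f ∈ N ↔ ∀ n < k, f n = 0 := fun f => Iff.rfl
    refine ⟨N, ⟨?_, ?_, ?_⟩, ?_, ?_⟩
    · intro f hf n hn
      rw [mulX_eq, Tsh_apply]
      exact hf _ (by omega)
    · intro f hf n hn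
      have := dg_apply (fun n => lam ^ (((1 : ℕ) : ℤ) * n)) f n
      rw [hf n hn, mul_zero] at this
      exact this
    · intro f hf n hn
      rw [dunkl_apply]
      by_cases hnk : n = k - 1
      · have hs : ∑ j ∈ p.support, p j * f (n - j) = p (-1) * f (n + 1) := by
          rw [Finset.sum_eq_single (-1)]
          · simp
          · intro j _ hj
            rcases lt_or_gt_of_ne hj with h | h
            · rw [ha j h, zero_mul]
            · rw [hf _ (by omega), mul_zero]
          · intro h
            rw [Finsupp.notMem_support_iff.1 h, zero_mul]
        have hn1 : n + 1 = k := by omega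
        rw [hs, hn1, ← add_mul, rho]
        rw [show p (-1) + ((k : ℂ) + ∑ i ∈ Finset.Icc 1 (m - 1),
            2 * c i * (1 - lam ^ ((i : ℤ) * k)) / (1 - lam ^ (i : ℤ))) = 0 by rw [← hk]; ring,
          zero_mul]
      · rw [hf (n + 1) (by omega), mul_zero, add_zero]
        refine Finset.sum_eq_zero fun j _ => ?_
        by_cases h : j < -1
        · rw [ha j h, zero_mul]
        · rw [hf _ (by omega), mul_zero]
    · intro h
      have : Finsupp.single k (1 : ℂ) ∈ N := by
        rw [hmem]
        intro n hn
        simp [Finsupp.single_apply, hn.ne']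
      rw [h, Submodule.mem_bot] at this
      simp at this
    · intro h
      have : Finsupp.single (k - 1) (1 : ℂ) ∈ N := h ▸ Submodule.mem_top
      have := (hmem _).1 this (k - 1) (by omega)
      simp at this
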